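/- Let J₁₅ : ℝ² → ℝ be defined by J₁₅(x,y) = −1 + 2·Re(j₁₅(x+iy, x−iy)) where j₁₅(u,v) = (50−125b)u³ − (15+125b)u⁶ − 75b·u⁹ − 15b·u¹² − b·u¹⁵ + (75/2)uv − (225−750b)u⁴v + (15+525b)u⁷v + 165b·u¹⁰v + 15b·u¹³v − 225u²v² + (315−1575b)u⁵v² − 675b·u⁸v² − 90b·u¹¹v² + 525u³v³ − (140−1400b)u⁶v³ + 275b·u⁹v³ − 525u⁴v⁴ − 450b·u⁷v⁴ + 189u⁵v⁵ and b = exp(−iπ/3). Then J₁₅ has exactly 196 critical points in ℝ²; at every critical point the value of J₁₅ is 0, −1, or 8; exactly 105 critical points have value 0, exactly 61 have value −1, and exactly 30 have value 8. -/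

import Mathlib

noncomputable section

/-- `bC = exp(-iπ/3)`. -/
def bC : ℂ := Complex.exp (-((Real.pi : ℂ) / 3) * Complex.I)

/-- The polynomial `j15(u,v)`. -/
def j15 (u v : ℂ) : ℂ := (50 - 125*bC)*u^3 - (15 + 125*bC)*u^6 - 75*bC*u^9 - 15*bC*u^12 - bC*u^15 + (75/2)*u*v - (225 - 750*bC)*u^4*v + (15 + 525*bC)*u^7*v + 165*bC*u^10*v + 15*bC*u^13*v - 225*u^2*v^2 + (315 - 1575*bC)*u^5*v^2 - 675*bC*u^8*v^2 - 90*bC*u^11*v^2 + 525*u^3*v^3 - (140 - 1400*bC)*u^6*v^3 + 275*bC*u^9*v^3 - 525*u^4*v^4 - 450*bC*u^7*v^4 + 189*u^5*v^5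

/-- The real folding-type polynomial `J15(x,y) = -1 + 2 Re(j15(x+iy, x-iy))`, as a
function on `ℝ × ℝ`. -/
def J15 : ℝ × ℝ → ℝ := fun p =>
  -1 + 2 * (j15 ((p.1 : ℂ) + (p.2 : ℂ) * Complex.I) ((p.1 : ℂ) - (p.2 : ℂ) * Complex.I)).re

/-- Partial derivative in the first variable. -/
def pdx (f : ℝ × ℝ → ℝ) (p : ℝ × ℝ) : ℝ := deriv (fun t => f (t, p.2)) p.1

/-- Partial derivative in the second variable. -/
def pdy (f : ℝ × ℝ → ℝ) (p : ℝ × ℝ) : ℝ := deriv (fun t => f (p.1, t)) p.2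

/-- Determinant of the Hessian matrix of `f` at `p`. -/
def hessDet2 (f : ℝ × ℝ → ℝ) (p : ℝ × ℝ) : ℝ :=
  pdx (pdx f) p * pdy (pdy f) p - pdx (pdy f) p * pdy (pdx f) p


/-! ### Power sums and complete symmetric functions in terms of `e1 = u`, `e2 = v`, `e3 = 1` -/

def pp (u v : ℂ) : ℕ → ℂ
  | 0 => 3
  | 1 => u
  | 2 => u^2 - 2*v
  | (n+3) => u * pp u v (n+2) - v * pp u v (n+1) + pp u v n

def hh (u v : ℂ) : ℕ → ℂ
  | 0 => 1
  | 1 => u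
  | 2 => u^2 - v
  | (n+3) => u * hh u v (n+2) - v * hh u v (n+1) + hh u v n

def aa (x y : ℂ) : ℕ → ℂ
  | 0 => 1
  | 1 => x + y
  | (n+2) => (x + y) * aa x y (n+1) - x * y * aa x y n

/-- derivative of `pp` in direction `(du, dv)` -/
def dp (u v du dv : ℂ) : ℕ → ℂ
  | 0 => 0
  | 1 => du
  | 2 => 2*u*du - 2*dv
  | (n+3) => (du * pp u v (n+2) + u * dp u v du dv (n+2))
      - (dv * pp u v (n+1) + v * dp u v du dv (n+1)) + dp u v du dv n

lemma pp_eq (x y z : ℂ) (h : x*y*z = 1) (n : ℕ) :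
    pp (x+y+z) (x*y+y*z+z*x) n = x^n + y^n + z^n := by
  have : pp (x+y+z) (x*y+y*z+z*x) n = x^n + y^n + z^n ∧
      pp (x+y+z) (x*y+y*z+z*x) (n+1) = x^(n+1) + y^(n+1) + z^(n+1) ∧
      pp (x+y+z) (x*y+y*z+z*x) (n+2) = x^(n+2) + y^(n+2) + z^(n+2) := by
    induction n with
    | zero => refine ⟨?_, ?_, ?_⟩ <;> simp only [pp] <;> ring
    | succ n ih =>
      obtain ⟨h0, h1, h2⟩ := ih
      refine ⟨h1, h2, ?_⟩
      show pp _ _ (n+3) = _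
      rw [pp, h0, h1, h2]
      linear_combination (-(x^n+y^n+z^n)) * h
  exact this.1

lemma hh_aa (x y z : ℂ) (h : x*y*z = 1) (n : ℕ) :
    hh (x+y+z) (x*y+y*z+z*x) (n+1) - z * hh (x+y+z) (x*y+y*z+z*x) n = aa x y (n+1) := by
  have : hh (x+y+z) (x*y+y*z+z*x) (n+1) - z * hh (x+y+z) (x*y+y*z+z*x) n = aa x y (n+1) ∧
    hh (x+y+z) (x*y+y*z+z*x) (n+2) - z * hh (x+y+z) (x*y+y*z+z*x) (n+1) = aa x y (n+2) := by
    induction n with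
    | zero => refine ⟨?_, ?_⟩ <;> simp only [hh, aa] <;> ring
    | succ n ih =>
      obtain ⟨h0, h1⟩ := ih
      refine ⟨h1, ?_⟩
      show hh _ _ (n+3) - z * hh _ _ (n+2) = aa x y (n+3)
      rw [hh, aa, ← h0, ← h1]
      linear_combination (-hh (x+y+z) (x*y+y*z+z*x) n) * h
  exact this.1

lemma aa_mul (x y : ℂ) (n : ℕ) : (x - y) * aa x y n = x^(n+1) - y^(n+1) := by
  have : (x - y) * aa x y n = x^(n+1) - y^(n+1) ∧
      (x - y) * aa x y (n+1) = x^(n+2) - y^(n+2) := by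
    induction n with
    | zero => refine ⟨?_, ?_⟩ <;> simp only [aa] <;> ring
    | succ n ih =>
      obtain ⟨h0, h1⟩ := ih
      refine ⟨h1, ?_⟩
      show _ * aa x y (n+2) = _
      rw [aa]
      linear_combination (x+y) * h1 - x * y * h0
  exact this.1

lemma aa_self (x : ℂ) (n : ℕ) : aa x x n = (n+1) * x^n := by
  have : aa x x n = (n+1) * x^n ∧ aa x x (n+1) = (n+2) * x^(n+1) := by
    induction n with
    | zero => refine ⟨?_, ?_⟩ <;> simp [aa]; ring
    | succ n ih =>
      obtain ⟨h0, h1⟩ := ih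
      refine ⟨by rw [h1]; push_cast; ring, ?_⟩
      show aa x x (n+2) = _
      rw [aa, h0, h1]
      push_cast
      ring
  exact this.1

lemma aa_scale (c x y : ℂ) (n : ℕ) : aa (y*c) (c*x) n = c^n * aa x y n := by
  have : aa (y*c) (c*x) n = c^n * aa x y n ∧
      aa (y*c) (c*x) (n+1) = c^(n+1) * aa x y (n+1) := by
    induction n with
    | zero => refine ⟨?_, ?_⟩ <;> simp only [aa] <;> ring
    | succ n ih =>
      obtain ⟨h0, h1⟩ := ih
      refine ⟨h1, ?_⟩
      show aa _ _ (n+2) = _ * aa x y (n+2)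
      rw [aa, aa, h0, h1]
      ring
  exact this.1

lemma aa_zero_iff (x y : ℂ) (hx : x ≠ 0) : aa x y 14 = 0 ↔ x ≠ y ∧ x^15 = y^15 := by
  constructor
  · intro h
    refine ⟨?_, ?_⟩
    · rintro rfl
      rw [aa_self] at h
      have := pow_ne_zero 14 hx
      norm_num at h
      exact hx h
    · have := aa_mul x y 14
      rw [h] at this
      linear_combination -this
  · rintro ⟨h1, h2⟩
    have := aa_mul x y 14
    norm_num at this
    rw [h2, sub_self] at this
    exact (mul_eq_zero.mp this).resolve_left (sub_ne_zero.mpr h1)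

lemma pp_hh (u v : ℂ) (n : ℕ) :
    pp u v (n+3) = hh u v (n+3) - v * hh u v (n+1) + 2 * hh u v n := by
  have : pp u v (n+3) = hh u v (n+3) - v * hh u v (n+1) + 2 * hh u v n ∧
    pp u v (n+4) = hh u v (n+4) - v * hh u v (n+2) + 2 * hh u v (n+1) ∧
    pp u v (n+5) = hh u v (n+5) - v * hh u v (n+3) + 2 * hh u v (n+2) := by
    induction n with
    | zero => refine ⟨?_, ?_, ?_⟩ <;> simp only [pp, hh] <;> ring
    | succ n ih =>
      obtain ⟨h0, h1, h2⟩ := ih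
      refine ⟨h1, h2, ?_⟩
      show pp u v (n+6) = hh u v (n+6) - v * hh u v (n+4) + 2 * hh u v (n+3)
      rw [pp, h0, h1, h2]
      simp only [hh]
      ring
  exact this.1

lemma dp_gen (u v du dv : ℂ) (n : ℕ) :
    dp u v du dv (n+2) = (n+2) * (hh u v (n+1) * du - hh u v n * dv) := by
  have : dp u v du dv (n+2) = (n+2) * (hh u v (n+1) * du - hh u v n * dv) ∧
    dp u v du dv (n+3) = (n+3) * (hh u v (n+2) * du - hh u v (n+1) * dv) ∧
    dp u v du dv (n+4) = (n+4) * (hh u v (n+3) * du - hh u v (n+2) * dv) := by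
    induction n with
    | zero => refine ⟨?_, ?_, ?_⟩ <;> simp only [pp, hh, dp] <;> push_cast <;> ring
    | succ n ih =>
      obtain ⟨h0, h1, h2⟩ := ih
      refine ⟨by rw [h1]; push_cast; ring, by rw [h2]; push_cast; ring, ?_⟩
      show dp u v du dv (n+5) = _ * (hh u v (n+4) * du - hh u v (n+3) * dv)
      rw [dp, h0, h1, h2, pp_hh u v (n+1), pp_hh u v n]
      simp only [hh]
      push_cast
      ring
  exact this.1

lemma dp_eq (u v du dv : ℂ) :
    dp u v du dv 15 = 15 * (hh u v 14 * du - hh u v 13 * dv) := by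
  have := dp_gen u v du dv 13
  rw [this]
  norm_num

lemma pp_hasDeriv (U V : ℝ → ℂ) (du dv : ℂ) (t : ℝ) (hU : HasDerivAt U du t)
    (hV : HasDerivAt V dv t) (n : ℕ) :
    HasDerivAt (fun s => pp (U s) (V s) n) (dp (U t) (V t) du dv n) t := by
  have : HasDerivAt (fun s => pp (U s) (V s) n) (dp (U t) (V t) du dv n) t ∧
    HasDerivAt (fun s => pp (U s) (V s) (n+1)) (dp (U t) (V t) du dv (n+1)) t ∧
    HasDerivAt (fun s => pp (U s) (V s) (n+2)) (dp (U t) (V t) du dv (n+2)) t := by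
    induction n with
    | zero =>
      refine ⟨?_, ?_, ?_⟩ <;> simp only [pp, dp]
      · exact hasDerivAt_const _ _
      · exact hU
      · have h := (hU.mul hU).sub (hV.const_mul 2)
        have e : (fun s => U s ^ 2 - 2 * V s) = (U * U - fun s => 2 * V s) := by
          funext s; simp; ring
        rw [e]
        exact h.congr_deriv (by ring)
    | succ n ih =>
      obtain ⟨h0, h1, h2⟩ := ih
      refine ⟨h1, h2, ?_⟩
      show HasDerivAt (fun s => pp (U s) (V s) (n+3)) (dp (U t) (V t) du dv (n+3)) t
      simp only [pp, dp]
      exact ((hU.mul h2).sub (hV.mul h1)).add h0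
  exact this.1

/-! ### The constant `bC` -/

def zt : ℂ := Complex.exp (2 * Real.pi * Complex.I / (90 : ℕ))

lemma zt_prim : IsPrimitiveRoot zt 90 := Complex.isPrimitiveRoot_exp 90 (by norm_num)

lemma zt_pow_eq (a c : ℕ) : zt^a = zt^c ↔ a % 90 = c % 90 := by
  rw [(isOfFinOrder_iff_pow_eq_one.mpr ⟨90, by norm_num, zt_prim.pow_eq_one⟩).pow_eq_pow_iff_modEq,
    ← zt_prim.eq_orderOf]
  rfl

lemma zt_ne : zt ≠ 0 := Complex.exp_ne_zero _

lemma bC_zt : bC = zt^75 := by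
  have h : bC * zt^15 = 1 := by
    unfold bC zt
    rw [← Complex.exp_nat_mul, ← Complex.exp_add, Complex.exp_eq_one_iff]
    refine ⟨0, ?_⟩
    push_cast
    ring
  have h2 : zt^75 * zt^15 = 1 := by
    rw [← pow_add]; exact zt_prim.pow_eq_one
  exact mul_right_cancel₀ (pow_ne_zero 15 zt_ne) (h.trans h2.symm)

lemma zt45 : zt^45 = -1 := by
  have h : (zt^45 - 1) * (zt^45 + 1) = 0 := by
    have := zt_prim.pow_eq_one
    linear_combination this
  rcases mul_eq_zero.mp h with h | h
  · exfalso
    have : zt^45 = zt^0 := by rw [pow_zero]; linear_combination h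
    rw [zt_pow_eq] at this
    omega
  · linear_combination h

lemma zt_norm : ‖zt‖ = 1 := zt_prim.norm'_eq_one (by norm_num)

lemma conj_zt : (starRingEnd ℂ) zt = zt^89 := by
  have h1 : zt * (starRingEnd ℂ) zt = 1 := by
    rw [Complex.mul_conj, Complex.normSq_eq_norm_sq, zt_norm]; norm_num
  have h2 : zt * zt^89 = 1 := by
    have := zt_prim.pow_eq_one
    linear_combination this
  exact mul_left_cancel₀ zt_ne (h1.trans h2.symm)

lemma conj_zt_pow (m : ℕ) : zt^m * (starRingEnd ℂ) (zt^m) = 1 := by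
  rw [map_pow, conj_zt, ← mul_pow]
  have : zt * zt^89 = 1 := by
    have := zt_prim.pow_eq_one
    linear_combination this
  rw [this, one_pow]

lemma conj_bC : (starRingEnd ℂ) bC = zt^15 := by
  rw [bC_zt, map_pow, conj_zt, ← pow_mul, zt_pow_eq]

lemma zt30 : zt^30 = zt^15 - 1 := by
  have h : (zt^15 + 1) * (zt^30 - zt^15 + 1) = 0 := by
    have := zt45
    linear_combination this
  rcases mul_eq_zero.mp h with h | h
  · exfalso
    have : zt^15 = zt^45 := by rw [zt45]; linear_combination h
    rw [zt_pow_eq] at this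
    omega
  · linear_combination h

lemma zt15_bC : zt^15 = 1 - bC := by
  have h : zt^75 = zt^30 * zt^45 := by ring
  rw [bC_zt, h, zt45, zt30]; ring

lemma J15_eq (p : ℝ × ℝ) : J15 p = 2 - 2 * (bC * pp ((p.1 : ℂ) + (p.2 : ℂ) * Complex.I)
    ((p.1 : ℂ) - (p.2 : ℂ) * Complex.I) 15).re := by
  have hb : (starRingEnd ℂ) bC = 1 - bC := by rw [conj_bC, zt15_bC]
  have hr : ∀ w : ℂ, ((2 * w.re : ℝ) : ℂ) = w + (starRingEnd ℂ) w := by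
    intro w; rw [Complex.add_conj]
  have hi : (starRingEnd ℂ) ((p.1 : ℂ) + (p.2 : ℂ) * Complex.I)
      = (p.1 : ℂ) - (p.2 : ℂ) * Complex.I := by
    simp [sub_eq_add_neg]
  have hi' : (starRingEnd ℂ) ((p.1 : ℂ) - (p.2 : ℂ) * Complex.I)
      = (p.1 : ℂ) + (p.2 : ℂ) * Complex.I := by
    simp [sub_eq_add_neg]
  unfold J15
  apply Complex.ofReal_injective
  rw [Complex.ofReal_add, Complex.ofReal_sub, hr, hr]
  generalize ((p.1 : ℂ) + (p.2 : ℂ) * Complex.I) = u at *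
  generalize ((p.1 : ℂ) - (p.2 : ℂ) * Complex.I) = v at *
  simp only [j15, pp, map_add, map_sub, map_mul, map_pow, hi, hi', hb, map_ofNat, map_div₀]
  push_cast
  ring

def E1 (u v : ℂ) : ℂ := bC * hh u v 14 - zt^15 * hh v u 13
def E2 (u v : ℂ) : ℂ := bC * hh u v 13 - zt^15 * hh v u 14

lemma conj_hh (u v : ℂ) (n : ℕ) : (starRingEnd ℂ) (hh u v n)
    = hh ((starRingEnd ℂ) u) ((starRingEnd ℂ) v) n := by
  have : (starRingEnd ℂ) (hh u v n) = hh ((starRingEnd ℂ) u) ((starRingEnd ℂ) v) n ∧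
    (starRingEnd ℂ) (hh u v (n+1)) = hh ((starRingEnd ℂ) u) ((starRingEnd ℂ) v) (n+1) ∧
    (starRingEnd ℂ) (hh u v (n+2)) = hh ((starRingEnd ℂ) u) ((starRingEnd ℂ) v) (n+2) := by
    induction n with
    | zero => simp [hh]
    | succ n ih =>
      obtain ⟨h0, h1, h2⟩ := ih
      refine ⟨h1, h2, ?_⟩
      show (starRingEnd ℂ) (hh u v (n+3)) = hh _ _ (n+3)
      simp only [hh, map_add, map_sub, map_mul, h0, h1, h2]
  exact this.1

lemma conj_zt15 : (starRingEnd ℂ) (zt^15) = bC := by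
  rw [← conj_bC, Complex.conj_conj]

lemma conj_E1 (u v : ℂ) (h : (starRingEnd ℂ) u = v) : (starRingEnd ℂ) (E1 u v) = - E2 u v := by
  have h' : (starRingEnd ℂ) v = u := by rw [← h, Complex.conj_conj]
  unfold E1 E2
  rw [map_sub, map_mul, map_mul, conj_zt15, conj_bC, conj_hh, conj_hh, h, h']
  ring

lemma crit_iff_E1 (p : ℝ × ℝ) : (pdx J15 p = 0 ∧ pdy J15 p = 0) ↔
    E1 ((p.1 : ℂ) + (p.2 : ℂ) * Complex.I) ((p.1 : ℂ) - (p.2 : ℂ) * Complex.I) = 0 := by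
  have hof : ∀ t : ℝ, HasDerivAt (fun s : ℝ => (s : ℂ)) 1 t := fun t =>
    Complex.ofRealCLM.hasDerivAt
  have key : ∀ (U V : ℝ → ℂ) (du dv : ℂ) (t : ℝ), HasDerivAt U du t → HasDerivAt V dv t →
      HasDerivAt (fun s => 2 - 2 * (bC * pp (U s) (V s) 15).re)
        (- (2 * (bC * (15 * (hh (U t) (V t) 14 * du - hh (U t) (V t) 13 * dv))).re)) t := by
    intro U V du dv t hU hV
    have h1 := (pp_hasDeriv U V du dv t hU hV 15).const_mul bC
    rw [dp_eq] at h1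
    have h2 := Complex.reCLM.hasFDerivAt.comp_hasDerivAt t h1
    have h3 := (h2.const_mul 2).const_sub 2
    exact h3
  have hx := by
    have hx' : pdx J15 p = deriv (fun t : ℝ => 2 - 2 * (bC * pp ((t : ℂ) + (p.2 : ℂ) * Complex.I)
        ((t : ℂ) - (p.2 : ℂ) * Complex.I) 15).re) p.1 := by
      unfold pdx
      simp only [J15_eq]
    exact hx'.trans (key (fun s => (s : ℂ) + (p.2 : ℂ) * Complex.I) (fun s => (s : ℂ) - (p.2 : ℂ) * Complex.I)
      1 1 p.1 ((hof _).add_const _) ((hof _).sub_const _)).deriv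
  have hy := by
    have hy' : pdy J15 p = deriv (fun t : ℝ => 2 - 2 * (bC * pp ((p.1 : ℂ) + (t : ℂ) * Complex.I)
        ((p.1 : ℂ) - (t : ℂ) * Complex.I) 15).re) p.2 := by
      unfold pdy
      simp only [J15_eq]
    exact hy'.trans (key (fun s => (p.1 : ℂ) + (s : ℂ) * Complex.I) (fun s => (p.1 : ℂ) - (s : ℂ) * Complex.I)
      (1 * Complex.I) (-(1 * Complex.I)) p.2 (((hof _).mul_const _).const_add _)
      (((hof _).mul_const _).const_sub _)).deriv
  rw [hx, hy]
  have hi : (starRingEnd ℂ) ((p.1 : ℂ) + (p.2 : ℂ) * Complex.I)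
      = (p.1 : ℂ) - (p.2 : ℂ) * Complex.I := by
    simp [sub_eq_add_neg]
  have hh13 : (starRingEnd ℂ) (hh ((p.1 : ℂ) + (p.2 : ℂ) * Complex.I)
     ((p.1 : ℂ) - (p.2 : ℂ) * Complex.I) 13) = hh ((p.1 : ℂ) - (p.2 : ℂ) * Complex.I)
     ((p.1 : ℂ) + (p.2 : ℂ) * Complex.I) 13 := by
    rw [conj_hh, hi, ← hi, Complex.conj_conj]
  unfold E1
  rw [← hh13, ← conj_bC]
  generalize hh ((p.1 : ℂ) + (p.2 : ℂ) * Complex.I) ((p.1 : ℂ) - (p.2 : ℂ) * Complex.I) 14 = A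
  generalize hh ((p.1 : ℂ) + (p.2 : ℂ) * Complex.I) ((p.1 : ℂ) - (p.2 : ℂ) * Complex.I) 13 = B
  rw [← map_mul]
  have e1 : bC * (15 * (A * 1 - B * 1)) = ((15 : ℝ) : ℂ) * (bC * A - bC * B) := by
    push_cast; ring
  have e2 : bC * (15 * (A * (1 * Complex.I) - B * (-(1 * Complex.I))))
      = ((15 : ℝ) : ℂ) * (bC * A + bC * B) * Complex.I := by
    push_cast; ring
  rw [e1, e2]
  generalize bC * A = X
  generalize bC * B = Y
  rw [Complex.ext_iff]
  simp only [Complex.re_ofReal_mul, Complex.mul_I_re, Complex.im_ofReal_mul, Complex.sub_re,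
    Complex.sub_im, Complex.add_im, Complex.conj_re, Complex.conj_im, Complex.zero_re,
    Complex.zero_im]
  constructor
  · rintro ⟨h1, h2⟩; constructor <;> linarith
  · rintro ⟨h1, h2⟩; constructor <;> linarith

lemma E_rel (x y z : ℂ) (h : x*y*z = 1) :
    E1 (x+y+z) (x*y+y*z+z*x) - z * E2 (x+y+z) (x*y+y*z+z*x)
      = aa x y 14 * (bC + zt^15 * z^15) := by
  have h1 := hh_aa x y z h 13
  have h2 := hh_aa (y*z) (z*x) (x*y) (by linear_combination (x*y*z+1) * h) 13
  have s1 : y*z + z*x + x*y = x*y+y*z+z*x := by ring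
  have s2 : y*z*(z*x) + z*x*(x*y) + x*y*(y*z) = x + y + z := by
    linear_combination (x+y+z) * h
  rw [s1, s2, aa_scale] at h2
  norm_num at h1 h2
  unfold E1 E2
  linear_combination bC * h1 + zt^15 * z * h2 + zt^15 * hh (x*y+y*z+z*x) (x+y+z) 13 * h

/-! ### Solving the critical equations -/

lemma solve_factor (A z : ℂ) (h : A * (bC + zt^15 * z^15) = 0) : A = 0 ∨ z^15 = zt^15 := by
  rcases mul_eq_zero.mp h with h | h
  · exact Or.inl h
  · right
    have h45 := zt45
    rw [bC_zt] at h
    have h2 : zt^15 * (z^15 - zt^15) = 0 := by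
      linear_combination h - zt^30 * h45
    exact sub_eq_zero.mp ((mul_eq_zero.mp h2).resolve_left (pow_ne_zero _ zt_ne))

lemma crit_forward (x y z : ℂ) (h : x*y*z = 1)
    (hc : (starRingEnd ℂ) (x+y+z) = x*y+y*z+z*x) (hE : E1 (x+y+z) (x*y+y*z+z*x) = 0) :
    (x ≠ y ∧ y ≠ z ∧ z ≠ x) ∧ ((x^15 = y^15 ∧ y^15 = z^15) ∨ (x^15 = zt^15 ∧ y^15 = zt^15) ∨
      (y^15 = zt^15 ∧ z^15 = zt^15) ∨ (z^15 = zt^15 ∧ x^15 = zt^15)) := by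
  have hE2 : E2 (x+y+z) (x*y+y*z+z*x) = 0 := by
    have := conj_E1 _ _ hc
    rw [hE, map_zero] at this
    linear_combination this
  have hx : x ≠ 0 := by rintro rfl; simp at h
  have hy : y ≠ 0 := by rintro rfl; simp at h
  have hz : z ≠ 0 := by rintro rfl; simp at h
  have r1 := E_rel x y z h
  have r2 := E_rel y z x (by linear_combination h)
  have r3 := E_rel z x y (by linear_combination h)
  have a1 : y + z + x = x + y + z := by ring
  have a2 : y*z + z*x + x*y = x*y+y*z+z*x := by ring
  have a3 : z + x + y = x + y + z := by ring
  have a4 : z*x + x*y + y*z = x*y+y*z+z*x := by ring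
  rw [a1, a2] at r2
  rw [a3, a4] at r3
  rw [hE, hE2, mul_zero, sub_zero] at r1 r2 r3
  have c1 := solve_factor _ _ r1.symm
  have c2 := solve_factor _ _ r2.symm
  have c3 := solve_factor _ _ r3.symm
  rw [aa_zero_iff _ _ hx] at c1
  rw [aa_zero_iff _ _ hy] at c2
  rw [aa_zero_iff _ _ hz] at c3
  have hprod : x^15 * y^15 * z^15 = 1 := by rw [← mul_pow, ← mul_pow, h, one_pow]
  have hng : ¬ (x^15 = zt^15 ∧ y^15 = zt^15 ∧ z^15 = zt^15) := by
    rintro ⟨e1, e2, e3⟩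
    rw [e1, e2, e3] at hprod
    have h45 := zt45
    have : (2 : ℂ) = 0 := by linear_combination h45 - hprod
    norm_num at this
  have d1 : x ≠ y := by rintro rfl; grind
  have d2 : y ≠ z := by rintro rfl; grind
  have d3 : z ≠ x := by rintro rfl; grind
  refine ⟨⟨d1, d2, d3⟩, ?_⟩
  grind

lemma crit_backward (x y z : ℂ) (h : x*y*z = 1) (hxy : x ≠ y) (hyz : y ≠ z) (hzx : z ≠ x)
    (hh : (x^15 = y^15 ∧ y^15 = z^15) ∨ (x^15 = zt^15 ∧ y^15 = zt^15)) :
    E1 (x+y+z) (x*y+y*z+z*x) = 0 := by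
  have hx : x ≠ 0 := by rintro rfl; simp at h
  have hy : y ≠ 0 := by rintro rfl; simp at h
  have hz : z ≠ 0 := by rintro rfl; simp at h
  have r1 := E_rel x y z h
  have r2 := E_rel y z x (by linear_combination h)
  have r3 := E_rel z x y (by linear_combination h)
  have a1 : y + z + x = x + y + z := by ring
  have a2 : y*z + z*x + x*y = x*y+y*z+z*x := by ring
  have a3 : z + x + y = x + y + z := by ring
  have a4 : z*x + x*y + y*z = x*y+y*z+z*x := by ring
  rw [a1, a2] at r2
  rw [a3, a4] at r3
  have q1 : aa x y 14 = 0 := by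
    rw [aa_zero_iff _ _ hx]; grind
  rw [q1, zero_mul] at r1
  have hg : bC + zt^15 * zt^15 = 0 := by
    rw [bC_zt]; linear_combination zt^30 * zt45
  have q2 : E1 (x+y+z) (x*y+y*z+z*x) - x * E2 (x+y+z) (x*y+y*z+z*x) = 0 := by
    rw [r2]
    rcases hh with ⟨e1, e2⟩ | ⟨e1, e2⟩
    · have : aa y z 14 = 0 := by rw [aa_zero_iff _ _ hy]; exact ⟨hyz, e2⟩
      rw [this, zero_mul]
    · rw [e1, hg, mul_zero]
  have q3 : (z - x) * E2 (x+y+z) (x*y+y*z+z*x) = 0 := by linear_combination q2 - r1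
  have q4 := (mul_eq_zero.mp q3).resolve_left (sub_ne_zero.mpr hzx)
  rw [q4] at q2
  linear_combination q2

lemma exists_roots (u v : ℂ) : ∃ x y z : ℂ, x*y*z = 1 ∧ x+y+z = u ∧ x*y+y*z+z*x = v := by
  obtain ⟨x, hx⟩ : ∃ x : ℂ, x^3 - u*x^2 + v*x - 1 = 0 := by
    open Polynomial in
    have hd : (X^3 - C u * X^2 + C v * X - C 1 : ℂ[X]).degree ≠ 0 := by
      have : (X^3 - C u * X^2 + C v * X - C 1 : ℂ[X]).degree = 3 := by compute_degree!
      rw [this]; norm_num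
    obtain ⟨x, hx⟩ := IsAlgClosed.exists_root _ hd
    refine ⟨x, ?_⟩
    simpa [Polynomial.IsRoot] using hx
  have hx0 : x ≠ 0 := by rintro rfl; simp at hx
  obtain ⟨d, hd⟩ := IsAlgClosed.exists_eq_mul_self ((u-x)^2 - 4 * (v - x*(u-x)))
  refine ⟨x, (u-x+d)/2, (u-x-d)/2, ?_, ?_, ?_⟩
  · linear_combination hx + x/4 * hd
  · ring
  · linear_combination (1/4) * hd

/-! ### The explicit list of critical points -/

def thd (q : ℕ × ℕ) : ℕ := (180 - q.1 - q.2) % 90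

def FF (q : ℕ × ℕ) : ℂ := zt^q.1 + zt^q.2 + zt^(thd q)

def pt (q : ℕ × ℕ) : ℝ × ℝ := ((FF q).re, (FF q).im)

def T0 : Finset (ℕ × ℕ) := (Finset.range 90 ×ˢ Finset.range 90).filter
  fun q => q.1 < q.2 ∧ q.1 % 6 = 1 ∧ q.2 % 6 = 1

def Tm : Finset (ℕ × ℕ) := (Finset.range 90 ×ˢ Finset.range 90).filter
  fun q => q.1 < q.2 ∧ q.2 < (180 - q.1 - q.2) % 90 ∧
    ((q.1 % 6 = 0 ∧ q.2 % 6 = 0) ∨ (q.1 % 6 = 2 ∧ q.2 % 6 = 2))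

def T8 : Finset (ℕ × ℕ) := (Finset.range 90 ×ˢ Finset.range 90).filter
  fun q => q.1 < q.2 ∧ q.2 < (180 - q.1 - q.2) % 90 ∧ q.1 % 6 = 4 ∧ q.2 % 6 = 4

lemma mem_T0 (q : ℕ × ℕ) : q ∈ T0 ↔ (q.1 < 90 ∧ q.2 < 90) ∧
    (q.1 < q.2 ∧ q.1 % 6 = 1 ∧ q.2 % 6 = 1) := by
  simp only [T0, Finset.mem_filter, Finset.mem_product, Finset.mem_range]

lemma mem_Tm (q : ℕ × ℕ) : q ∈ Tm ↔ (q.1 < 90 ∧ q.2 < 90) ∧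
    (q.1 < q.2 ∧ q.2 < (180 - q.1 - q.2) % 90 ∧
    ((q.1 % 6 = 0 ∧ q.2 % 6 = 0) ∨ (q.1 % 6 = 2 ∧ q.2 % 6 = 2))) := by
  simp only [Tm, Finset.mem_filter, Finset.mem_product, Finset.mem_range]

lemma mem_T8 (q : ℕ × ℕ) : q ∈ T8 ↔ (q.1 < 90 ∧ q.2 < 90) ∧
    (q.1 < q.2 ∧ q.2 < (180 - q.1 - q.2) % 90 ∧ q.1 % 6 = 4 ∧ q.2 % 6 = 4) := by
  simp only [T8, Finset.mem_filter, Finset.mem_product, Finset.mem_range]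

/-- Pairs with both entries congruent to `r` modulo `6`, reparametrized by `range 15`. -/
lemma card_aux (P : ℕ × ℕ → Prop) [DecidablePred P] (r : ℕ) (hr : r < 6) (S : Finset (ℕ × ℕ))
    (hS : ∀ q : ℕ × ℕ, q ∈ S ↔ (q.1 < 90 ∧ q.2 < 90) ∧ (P q ∧ q.1 % 6 = r ∧ q.2 % 6 = r)) :
    S.card = ((Finset.range 15 ×ˢ Finset.range 15).filter
      fun k => P (6 * k.1 + r, 6 * k.2 + r)).card := by
  symm
  apply Finset.card_bij (fun k _ => (6 * k.1 + r, 6 * k.2 + r))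
  · intro k hk
    simp only [Finset.mem_filter, Finset.mem_product, Finset.mem_range] at hk
    rw [hS]
    refine ⟨⟨?_, ?_⟩, hk.2, ?_, ?_⟩ <;> dsimp only <;> omega
  · intro k _ l _ h
    rw [Prod.mk.injEq] at h
    apply Prod.ext <;> omega
  · intro q hq
    rw [hS] at hq
    have e : ((6 * (q.1 / 6) + r, 6 * (q.2 / 6) + r) : ℕ × ℕ) = q := by
      apply Prod.ext <;> dsimp only <;> omega
    refine ⟨(q.1 / 6, q.2 / 6), ?_, e⟩
    simp only [Finset.mem_filter, Finset.mem_product, Finset.mem_range]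
    refine ⟨⟨?_, ?_⟩, ?_⟩
    · omega
    · omega
    · rw [e]; exact hq.2.1

lemma T0_card : T0.card = 105 := by
  rw [card_aux (fun q => q.1 < q.2) 1 (by norm_num) T0 mem_T0]
  decide +kernel

lemma T8_card : T8.card = 30 := by
  rw [card_aux (fun q => q.1 < q.2 ∧ q.2 < (180 - q.1 - q.2) % 90) 4 (by norm_num) T8
    (fun q => by rw [mem_T8]; tauto)]
  decide +kernel

lemma Tm_card : Tm.card = 61 := by
  have h := Finset.card_filter_add_card_filter_not (s := Tm) (fun q => q.1 % 6 = 0)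
  rw [← h, card_aux (fun q => q.1 < q.2 ∧ q.2 < (180 - q.1 - q.2) % 90) 0 (by norm_num)
    (Tm.filter fun q => q.1 % 6 = 0) (fun q => by rw [Finset.mem_filter, mem_Tm]; omega),
    card_aux (fun q => q.1 < q.2 ∧ q.2 < (180 - q.1 - q.2) % 90) 2 (by norm_num)
    (Tm.filter fun q => ¬ q.1 % 6 = 0) (fun q => by rw [Finset.mem_filter, mem_Tm]; omega)]
  decide +kernel

attribute [irreducible] T0 Tm T8

lemma prod_one (a b c : ℕ) (h : (a + b + c) % 90 = 0) : zt^a * zt^b * zt^c = 1 := by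
  rw [← pow_add, ← pow_add, ← pow_zero zt, zt_pow_eq]
  omega

lemma conj_sum (a b c : ℕ) (h : (a + b + c) % 90 = 0) :
    (starRingEnd ℂ) (zt^a + zt^b + zt^c) = zt^a*zt^b + zt^b*zt^c + zt^c*zt^a := by
  have hp := prod_one a b c h
  have ha := conj_zt_pow a
  have hb := conj_zt_pow b
  have hc := conj_zt_pow c
  rw [map_add, map_add]
  have ea : (starRingEnd ℂ) (zt^a) = zt^b * zt^c :=
    mul_left_cancel₀ (pow_ne_zero a zt_ne) (by linear_combination ha - hp)
  have eb : (starRingEnd ℂ) (zt^b) = zt^c * zt^a :=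
    mul_left_cancel₀ (pow_ne_zero b zt_ne) (by linear_combination hb - hp)
  have ec : (starRingEnd ℂ) (zt^c) = zt^a * zt^b :=
    mul_left_cancel₀ (pow_ne_zero c zt_ne) (by linear_combination hc - hp)
  rw [ea, eb, ec]
  ring

lemma thd_sum (q : ℕ × ℕ) (h : q.1 < 90 ∧ q.2 < 90) : (q.1 + q.2 + thd q) % 90 = 0 := by
  unfold thd; omega

lemma pt_add (q : ℕ × ℕ) : ((pt q).1 : ℂ) + ((pt q).2 : ℂ) * Complex.I = FF q :=
  Complex.re_add_im _

lemma pt_sub (q : ℕ × ℕ) : ((pt q).1 : ℂ) - ((pt q).2 : ℂ) * Complex.I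
    = (starRingEnd ℂ) (FF q) := by
  rw [← pt_add q]; simp [sub_eq_add_neg]

lemma zpow15 (m : ℕ) : (zt^m)^15 = zt^(15*m) := by rw [← pow_mul, mul_comm]

lemma crit_T (q : ℕ × ℕ) (hq : q ∈ T0 ∨ q ∈ Tm ∨ q ∈ T8) :
    pdx J15 (pt q) = 0 ∧ pdy J15 (pt q) = 0 := by
  rw [mem_T0, mem_Tm, mem_T8] at hq
  have hlt : q.1 < 90 ∧ q.2 < 90 := by omega
  have hs := thd_sum q hlt
  rw [crit_iff_E1, pt_add, pt_sub]
  unfold FF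
  rw [conj_sum _ _ _ hs]
  apply crit_backward _ _ _ (prod_one _ _ _ hs)
  · rw [Ne, zt_pow_eq]; omega
  · rw [Ne, zt_pow_eq]; unfold thd; omega
  · rw [Ne, zt_pow_eq]; unfold thd; omega
  · simp only [zpow15, zt_pow_eq]; unfold thd; omega

lemma J15_pt (q : ℕ × ℕ) (h : q.1 < 90 ∧ q.2 < 90) :
    J15 (pt q) = 2 - 2 * (zt^(75 + 15*q.1) + zt^(75 + 15*q.2) + zt^(75 + 15*thd q)).re := by
  have hs := thd_sum q h
  rw [J15_eq, pt_add, pt_sub]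
  unfold FF
  rw [conj_sum _ _ _ hs, pp_eq _ _ _ (prod_one _ _ _ hs), bC_zt, zpow15, zpow15, zpow15]
  simp only [pow_add]
  ring_nf

lemma re15 : (zt^15).re = 1/2 := by
  have h1 := congrArg Complex.re zt15_bC
  have h2 := congrArg Complex.re conj_bC
  simp only [Complex.conj_re, Complex.sub_re, Complex.one_re] at h1 h2
  linarith

lemma re75 : (zt^75).re = 1/2 := by
  have h1 := congrArg Complex.re zt15_bC
  rw [← bC_zt]
  rw [Complex.sub_re, Complex.one_re, re15] at h1
  linarith

lemma J15_T0 (q : ℕ × ℕ) (hq : q ∈ T0) : J15 (pt q) = 0 := by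
  rw [mem_T0] at hq
  rw [J15_pt q hq.1]
  have e1 : zt^(75 + 15*q.1) = zt^0 := by rw [zt_pow_eq]; omega
  have e2 : zt^(75 + 15*q.2) = zt^0 := by rw [zt_pow_eq]; omega
  have e3 : zt^(75 + 15*thd q) = zt^45 := by rw [zt_pow_eq]; unfold thd; omega
  rw [e1, e2, e3, zt45]
  norm_num

lemma J15_T8 (q : ℕ × ℕ) (hq : q ∈ T8) : J15 (pt q) = 8 := by
  rw [mem_T8] at hq
  rw [J15_pt q hq.1]
  have e1 : zt^(75 + 15*q.1) = zt^45 := by rw [zt_pow_eq]; omega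
  have e2 : zt^(75 + 15*q.2) = zt^45 := by rw [zt_pow_eq]; omega
  have e3 : zt^(75 + 15*thd q) = zt^45 := by rw [zt_pow_eq]; unfold thd; omega
  rw [e1, e2, e3, zt45]
  norm_num

lemma J15_Tm (q : ℕ × ℕ) (hq : q ∈ Tm) : J15 (pt q) = -1 := by
  rw [mem_Tm] at hq
  rw [J15_pt q hq.1]
  obtain ⟨h1, h2, h3, h4 | h4⟩ := hq
  · have e1 : zt^(75 + 15*q.1) = zt^75 := by rw [zt_pow_eq]; omega
    have e2 : zt^(75 + 15*q.2) = zt^75 := by rw [zt_pow_eq]; omega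
    have e3 : zt^(75 + 15*thd q) = zt^75 := by rw [zt_pow_eq]; unfold thd; omega
    rw [e1, e2, e3, Complex.add_re, Complex.add_re, re75]
    norm_num
  · have e1 : zt^(75 + 15*q.1) = zt^15 := by rw [zt_pow_eq]; omega
    have e2 : zt^(75 + 15*q.2) = zt^15 := by rw [zt_pow_eq]; omega
    have e3 : zt^(75 + 15*thd q) = zt^15 := by rw [zt_pow_eq]; unfold thd; omega
    rw [e1, e2, e3, Complex.add_re, Complex.add_re, re15]
    norm_num

lemma root_mem (x y z x' y' z' : ℂ) (h : x*y*z = 1) (h' : x'*y'*z' = 1)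
    (h1 : x+y+z = x'+y'+z') (h2 : x*y+y*z+z*x = x'*y'+y'*z'+z'*x') :
    x = x' ∨ x = y' ∨ x = z' := by
  have : (x - x') * ((x - y') * (x - z')) = 0 := by
    linear_combination x^2 * h1 - x * h2 + h - h'
  rcases mul_eq_zero.mp this with h | h
  · exact Or.inl (sub_eq_zero.mp h)
  · rcases mul_eq_zero.mp h with h | h
    · exact Or.inr (Or.inl (sub_eq_zero.mp h))
    · exact Or.inr (Or.inr (sub_eq_zero.mp h))

lemma pt_inj (q r : ℕ × ℕ) (hq : q ∈ T0 ∨ q ∈ Tm ∨ q ∈ T8) (hr : r ∈ T0 ∨ r ∈ Tm ∨ r ∈ T8)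
    (h : pt q = pt r) : q = r := by
  rw [mem_T0, mem_Tm, mem_T8] at hq hr
  have hq1 : q.1 < 90 ∧ q.2 < 90 := by omega
  have hr1 : r.1 < 90 ∧ r.2 < 90 := by omega
  have sq := thd_sum q hq1
  have sr := thd_sum r hr1
  have hF : FF q = FF r := by rw [← pt_add q, ← pt_add r, h]
  have hF2 := congrArg (starRingEnd ℂ) hF
  unfold FF at hF hF2
  rw [conj_sum _ _ _ sq, conj_sum _ _ _ sr] at hF2
  have pq := prod_one _ _ _ sq
  have pr := prod_one _ _ _ sr
  have m1 := root_mem _ _ _ _ _ _ pq pr hF hF2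
  have m2 := root_mem (zt^q.2) (zt^(thd q)) (zt^q.1) _ _ _ (by linear_combination pq) pr
    (by linear_combination hF) (by linear_combination hF2)
  have m3 := root_mem (zt^(thd q)) (zt^q.1) (zt^q.2) _ _ _ (by linear_combination pq) pr
    (by linear_combination hF) (by linear_combination hF2)
  simp only [zt_pow_eq] at m1 m2 m3
  have tq : thd q = (180 - q.1 - q.2) % 90 := rfl
  have tr : thd r = (180 - r.1 - r.2) % 90 := rfl
  rw [← tq] at hq
  rw [← tr] at hr
  have tq' : thd q < 90 := by omega
  have tr' : thd r < 90 := by omega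
  clear tq tr
  rw [Nat.mod_eq_of_lt hq1.1, Nat.mod_eq_of_lt hr1.1, Nat.mod_eq_of_lt hr1.2,
    Nat.mod_eq_of_lt tr'] at m1
  rw [Nat.mod_eq_of_lt hq1.2, Nat.mod_eq_of_lt hr1.1, Nat.mod_eq_of_lt hr1.2,
    Nat.mod_eq_of_lt tr'] at m2
  rw [Nat.mod_eq_of_lt tq', Nat.mod_eq_of_lt hr1.1, Nat.mod_eq_of_lt hr1.2,
    Nat.mod_eq_of_lt tr'] at m3
  apply Prod.ext <;> omega

lemma sorted_mem (a b c : ℕ) (hab : a < b) (hbc : b < c) (hc : c < 90)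
    (hs : (a + b + c) % 90 = 0) (h1 : a % 6 = b % 6) (h2 : a % 2 = 0) :
    ∃ q : ℕ × ℕ, (q ∈ T0 ∨ q ∈ Tm ∨ q ∈ T8) ∧ FF q = zt^a + zt^b + zt^c := by
  have hc' : (180 - a - b) % 90 = c := by omega
  refine ⟨(a, b), ?_, ?_⟩
  · rw [mem_T0, mem_Tm, mem_T8]
    dsimp only
    rw [hc']
    clear hc' hs
    omega
  · have : thd (a, b) = c := by
      unfold thd; dsimp only; omega
    simp only [FF, this]

lemma pair_mem (a b c : ℕ) (hab : a ≠ b) (ha : a < 90) (hb : b < 90) (hc : c < 90)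
    (hs : (a + b + c) % 90 = 0) (h1 : a % 6 = 1) (h2 : b % 6 = 1) :
    ∃ q : ℕ × ℕ, (q ∈ T0 ∨ q ∈ Tm ∨ q ∈ T8) ∧ FF q = zt^a + zt^b + zt^c := by
  rcases lt_or_gt_of_ne hab with h | h
  · refine ⟨(a, b), Or.inl ?_, ?_⟩
    · rw [mem_T0]; dsimp only; omega
    · have : thd (a, b) = c := by
        unfold thd; dsimp only; omega
      simp only [FF, this]
  · refine ⟨(b, a), Or.inl ?_, ?_⟩
    · rw [mem_T0]; dsimp only; omega
    · have : thd (b, a) = c := by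
        unfold thd; dsimp only; omega
      simp only [FF, this]; ring

lemma triple_mem (a b c : ℕ) (hab : a ≠ b) (hbc : b ≠ c) (hca : c ≠ a)
    (ha : a < 90) (hb : b < 90) (hc : c < 90)
    (hs : (a + b + c) % 90 = 0) (h1 : a % 6 = b % 6) (h2 : b % 6 = c % 6) (h3 : a % 2 = 0) :
    ∃ q : ℕ × ℕ, (q ∈ T0 ∨ q ∈ Tm ∨ q ∈ T8) ∧ FF q = zt^a + zt^b + zt^c := by
  rcases lt_or_gt_of_ne hab with h | h <;> rcases lt_or_gt_of_ne hbc with h' | h' <;>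
    rcases lt_or_gt_of_ne hca with h'' | h''
  · omega
  · exact sorted_mem a b c (by omega) (by omega) (by omega) (by omega) (by omega) (by omega)
  · obtain ⟨q, hq, e⟩ :=
      sorted_mem c a b (by omega) (by omega) (by omega) (by omega) (by omega) (by omega)
    exact ⟨q, hq, by rw [e]; ring⟩
  · obtain ⟨q, hq, e⟩ :=
      sorted_mem a c b (by omega) (by omega) (by omega) (by omega) (by omega) (by omega)
    exact ⟨q, hq, by rw [e]; ring⟩
  · obtain ⟨q, hq, e⟩ :=
      sorted_mem b c a (by omega) (by omega) (by omega) (by omega) (by omega) (by omega)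
    exact ⟨q, hq, by rw [e]; ring⟩
  · obtain ⟨q, hq, e⟩ :=
      sorted_mem b a c (by omega) (by omega) (by omega) (by omega) (by omega) (by omega)
    exact ⟨q, hq, by rw [e]; ring⟩
  · obtain ⟨q, hq, e⟩ :=
      sorted_mem c b a (by omega) (by omega) (by omega) (by omega) (by omega) (by omega)
    exact ⟨q, hq, by rw [e]; ring⟩
  · omega

lemma surj_all (x y z : ℂ) (h : x*y*z = 1) (hxy : x ≠ y) (hyz : y ≠ z) (hzx : z ≠ x)
    (h1 : x^15 = y^15) (h2 : y^15 = z^15) :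
    ∃ q : ℕ × ℕ, (q ∈ T0 ∨ q ∈ Tm ∨ q ∈ T8) ∧ FF q = x + y + z := by
  have hprod : x^15 * y^15 * z^15 = 1 := by rw [← mul_pow, ← mul_pow, h, one_pow]
  have hz3 : (z^15)^3 = 1 := by rw [h1, h2] at hprod; linear_combination hprod
  have hy3 : (y^15)^3 = 1 := by rw [h2]; exact hz3
  have hx3 : (x^15)^3 = 1 := by rw [h1]; exact hy3
  obtain ⟨a, ha, rfl⟩ := zt_prim.eq_pow_of_pow_eq_one (ξ := x)
    (by linear_combination ((x^15)^3 + 1) * hx3)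
  obtain ⟨b, hb, rfl⟩ := zt_prim.eq_pow_of_pow_eq_one (ξ := y)
    (by linear_combination ((y^15)^3 + 1) * hy3)
  obtain ⟨c, hc, rfl⟩ := zt_prim.eq_pow_of_pow_eq_one (ξ := z)
    (by linear_combination ((z^15)^3 + 1) * hz3)
  rw [← pow_add, ← pow_add, ← pow_zero zt, zt_pow_eq] at h
  rw [Ne, zt_pow_eq] at hxy hyz hzx
  rw [zpow15, zpow15, zt_pow_eq] at h1 h2
  rw [zpow15, ← pow_mul, ← pow_zero zt, zt_pow_eq] at hx3
  exact triple_mem a b c (by omega) (by omega) (by omega) ha hb hc (by omega) (by omega)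
    (by omega) (by omega)

lemma surj_pair (x y z : ℂ) (h : x*y*z = 1) (hxy : x ≠ y)
    (h1 : x^15 = zt^15) (h2 : y^15 = zt^15) :
    ∃ q : ℕ × ℕ, (q ∈ T0 ∨ q ∈ Tm ∨ q ∈ T8) ∧ FF q = x + y + z := by
  have h90 := zt_prim.pow_eq_one
  have hx6 : x^90 = 1 := by
    have : x^90 = (x^15)^6 := by ring
    rw [this, h1, ← pow_mul, h90]
  have hy6 : y^90 = 1 := by
    have : y^90 = (y^15)^6 := by ring
    rw [this, h2, ← pow_mul, h90]
  have hz6 : z^90 = 1 := by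
    have : (x*y*z)^90 = 1 := by rw [h, one_pow]
    rwa [mul_pow, mul_pow, hx6, hy6, one_mul, one_mul] at this
  obtain ⟨a, ha, rfl⟩ := zt_prim.eq_pow_of_pow_eq_one hx6
  obtain ⟨b, hb, rfl⟩ := zt_prim.eq_pow_of_pow_eq_one hy6
  obtain ⟨c, hc, rfl⟩ := zt_prim.eq_pow_of_pow_eq_one hz6
  rw [← pow_add, ← pow_add, ← pow_zero zt, zt_pow_eq] at h
  rw [Ne, zt_pow_eq] at hxy
  rw [zpow15, zt_pow_eq] at h1 h2
  exact pair_mem a b c (by omega) ha hb hc (by omega) (by omega) (by omega)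

lemma surj (p : ℝ × ℝ) (hp : pdx J15 p = 0 ∧ pdy J15 p = 0) :
    ∃ q : ℕ × ℕ, (q ∈ T0 ∨ q ∈ Tm ∨ q ∈ T8) ∧ pt q = p := by
  rw [crit_iff_E1] at hp
  suffices hs : ∃ q : ℕ × ℕ, (q ∈ T0 ∨ q ∈ Tm ∨ q ∈ T8) ∧
      FF q = (p.1 : ℂ) + (p.2 : ℂ) * Complex.I by
    obtain ⟨q, hq, e⟩ := hs
    refine ⟨q, hq, ?_⟩
    unfold pt
    rw [e]
    apply Prod.ext <;> simp
  have hi : (starRingEnd ℂ) ((p.1 : ℂ) + (p.2 : ℂ) * Complex.I)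
      = (p.1 : ℂ) - (p.2 : ℂ) * Complex.I := by
    simp [sub_eq_add_neg]
  obtain ⟨x, y, z, h, hu, hv⟩ := exists_roots ((p.1 : ℂ) + (p.2 : ℂ) * Complex.I)
    ((p.1 : ℂ) - (p.2 : ℂ) * Complex.I)
  rw [← hu, ← hv] at hp hi
  rw [← hu]
  obtain ⟨⟨d1, d2, d3⟩, hc⟩ := crit_forward x y z h hi hp
  rcases hc with ⟨e1, e2⟩ | ⟨e1, e2⟩ | ⟨e1, e2⟩ | ⟨e1, e2⟩
  · exact surj_all x y z h d1 d2 d3 e1 e2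
  · exact surj_pair x y z h d1 e1 e2
  · obtain ⟨q, hq, e⟩ := surj_pair y z x (by linear_combination h) d2 e1 e2
    exact ⟨q, hq, by rw [e]; ring⟩
  · obtain ⟨q, hq, e⟩ := surj_pair z x y (by linear_combination h) d3 e1 e2
    exact ⟨q, hq, by rw [e]; ring⟩

lemma ncard_pt (S : Finset (ℕ × ℕ)) (hS : ∀ q ∈ S, q ∈ T0 ∨ q ∈ Tm ∨ q ∈ T8) :
    (pt '' (S : Set (ℕ × ℕ))).ncard = S.card := by
  rw [Set.InjOn.ncard_image, Set.ncard_coe_finset]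
  intro q hq r hr h
  exact pt_inj q r (hS q hq) (hS r hr) h

lemma crit_set : {p : ℝ × ℝ | pdx J15 p = 0 ∧ pdy J15 p = 0}
    = pt '' ((T0 ∪ (Tm ∪ T8) : Finset (ℕ × ℕ)) : Set (ℕ × ℕ)) := by
  ext p
  simp only [Set.mem_ofPred_eq, Set.mem_image, Finset.mem_coe, Finset.mem_union]
  constructor
  · exact surj p
  · rintro ⟨q, hq, rfl⟩
    exact crit_T q hq

lemma card_all : (T0 ∪ (Tm ∪ T8)).card = 196 := by
  rw [Finset.card_union_of_disjoint, Finset.card_union_of_disjoint, T0_card, Tm_card, T8_card]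
  · rw [Finset.disjoint_left]
    intro q h1 h2
    rw [mem_Tm] at h1
    rw [mem_T8] at h2
    omega
  · rw [Finset.disjoint_left]
    intro q h1 h2
    rw [Finset.mem_union, mem_Tm, mem_T8] at h2
    rw [mem_T0] at h1
    omega

/-- `J15` has exactly 196 critical points; every critical value is `0`, `-1` or `8`;
exactly 105 critical points have value `0`, exactly 61 have value `-1` and exactly 30
have value `8`. -/
theorem stmt :
    {p : ℝ × ℝ | pdx J15 p = 0 ∧ pdy J15 p = 0}.Finite ∧
    {p : ℝ × ℝ | pdx J15 p = 0 ∧ pdy J15 p = 0}.ncard = 196 ∧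
    (∀ p : ℝ × ℝ, pdx J15 p = 0 ∧ pdy J15 p = 0 →
      J15 p = 0 ∨ J15 p = -1 ∨ J15 p = 8) ∧
    {p : ℝ × ℝ | (pdx J15 p = 0 ∧ pdy J15 p = 0) ∧ J15 p = 0}.ncard = 105 ∧
    {p : ℝ × ℝ | (pdx J15 p = 0 ∧ pdy J15 p = 0) ∧ J15 p = -1}.ncard = 61 ∧
    {p : ℝ × ℝ | (pdx J15 p = 0 ∧ pdy J15 p = 0) ∧ J15 p = 8}.ncard = 30 := by
  refine ⟨?_, ?_, ?_, ?_, ?_, ?_⟩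
  · rw [crit_set]
    exact (Finset.finite_toSet _).image _
  · rw [crit_set, ncard_pt _ (by simp), card_all]
  · intro p hp
    obtain ⟨q, hq | hq | hq, rfl⟩ := surj p hp
    · exact Or.inl (J15_T0 q hq)
    · exact Or.inr (Or.inl (J15_Tm q hq))
    · exact Or.inr (Or.inr (J15_T8 q hq))
  · rw [← T0_card, ← ncard_pt T0 (fun q hq => Or.inl hq)]
    congr 1
    ext p
    constructor
    · rintro ⟨hp, hv⟩
      obtain ⟨q, hq | hq | hq, rfl⟩ := surj p hp
      · exact ⟨q, hq, rfl⟩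
      · rw [J15_Tm q hq] at hv; norm_num at hv
      · rw [J15_T8 q hq] at hv; norm_num at hv
    · rintro ⟨q, hq, rfl⟩
      exact ⟨crit_T q (Or.inl hq), J15_T0 q hq⟩
  · rw [← Tm_card, ← ncard_pt Tm (fun q hq => Or.inr (Or.inl hq))]
    congr 1
    ext p
    constructor
    · rintro ⟨hp, hv⟩
      obtain ⟨q, hq | hq | hq, rfl⟩ := surj p hp
      · rw [J15_T0 q hq] at hv; norm_num at hv
      · exact ⟨q, hq, rfl⟩
      · rw [J15_T8 q hq] at hv; norm_num at hv
    · rintro ⟨q, hq, rfl⟩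
      exact ⟨crit_T q (Or.inr (Or.inl hq)), J15_Tm q hq⟩
  · rw [← T8_card, ← ncard_pt T8 (fun q hq => Or.inr (Or.inr hq))]
    congr 1
    ext p
    constructor
    · rintro ⟨hp, hv⟩
      obtain ⟨q, hq | hq | hq, rfl⟩ := surj p hp
      · rw [J15_T0 q hq] at hv; norm_num at hv
      · rw [J15_Tm q hq] at hv; norm_num at hv
      · exact ⟨q, hq, rfl⟩
    · rintro ⟨q, hq, rfl⟩
      exact ⟨crit_T q (Or.inr (Or.inr hq)), J15_T8 q hq⟩
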